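/- Let M = (S, A, s0, P) be a reward-free MDP with finite state space S satisfying the RESET assumption and let L ≥ 1 be a real number. Then there exists J ≤ |S→_L| such that K*_j = S→_L for all j ≥ J; in other words, the J-fold iterate of T_L starting from {s0} equals S→_L, and S→_L is the limit of the iterates T_L^j({s0}). -/

import Mathlib

open scoped ENNReal Classical

/-- A reward-free MDP with countable state space `S`, action space `A` containing a
distinguished `RESET` action, initial state `s0`, and transition kernel `P`,
satisfying the RESET assumption. -/
structure RFMDP (S : Type) (A : Type) where
  s0 : S
  reset : A
  P : S → A → PMF S
  reset_eq : ∀ s : S, P s reset s0 = 1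

namespace RFMDP

variable {S A : Type}

/-- `survive M π g n s` is the probability that the Markov chain started at `s` and
following policy `π` has not yet hit the goal `g` within the first `n+1` visited states,
i.e. `P(T > n)` where `T = inf {i ≥ 0 : s_{i+1} = g}` and `s_1 = s`. -/
noncomputable def survive (M : RFMDP S A) (π : S → A) (g : S) : ℕ → S → ℝ≥0∞
  | 0, s => if s = g then 0 else 1
  | n + 1, s => if s = g then 0 else ∑' s' : S, M.P s (π s) s' * survive M π g n s'

/-- The value `V^π_g(s)`: the expected hitting time of the goal `g` starting from `s`
and following policy `π` (`+∞` if `g` is almost surely unreachable), computed as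
`E[T] = Σ_{n ≥ 0} P(T > n)`. -/
noncomputable def V (M : RFMDP S A) (π : S → A) (g s : S) : ℝ≥0∞ :=
  ∑' n : ℕ, M.survive π g n s

/-- The set `Π(X)` of policies restricted on `X`: those playing `RESET` outside `X`. -/
def restrictedPolicies (M : RFMDP S A) (X : Set S) : Set (S → A) :=
  {π | ∀ s ∉ X, π s = M.reset}

/-- `V*_{X,g}(s)`: the optimal hitting time of `g` from `s` over policies restricted on `X`. -/
noncomputable def Vstar (M : RFMDP S A) (X : Set S) (g s : S) : ℝ≥0∞ :=
  ⨅ π ∈ M.restrictedPolicies X, M.V π g s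

/-- The state-expansion operator `T_L`. -/
def TL (M : RFMDP S A) (L : ℝ) (X : Set S) : Set S :=
  {s | M.Vstar X s M.s0 ≤ ENNReal.ofReal L}

/-- `S_L^≺`: the least subset of `S` containing `s0` and closed under adding any state `s`
reachable in at most `L` expected steps from `s0` by a policy restricted on
`{s' ∈ S_L^≺ : s' ≺ s}`. -/
def SLprec (M : RFMDP S A) (L : ℝ) (prec : S → S → Prop) : Set S :=
  sInf {X : Set S | M.s0 ∈ X ∧
    ∀ s : S, (∃ π ∈ M.restrictedPolicies {s' ∈ X | prec s' s},
      M.V π s M.s0 ≤ ENNReal.ofReal L) → s ∈ X}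

/-- The set `S→_L` of incrementally `L`-controllable states: the union of `S_L^≺` over
all (strict) partial orders `≺` on `S`. -/
def SLarrow (M : RFMDP S A) (L : ℝ) : Set S :=
  ⋃ (prec : S → S → Prop) (_ : IsStrictOrder S prec), M.SLprec L prec

/-- The layer sequence: `layer 0 = {s0} = K*_1` and `layer (n+1) = T_L (layer n) = K*_{n+2}`. -/
noncomputable def layer (M : RFMDP S A) (L : ℝ) : ℕ → Set S
  | 0 => {M.s0}
  | n + 1 => M.TL L (M.layer L n)

end RFMDP

namespace RFMDP

variable {S A : Type}

theorem restrictedPolicies_mono (M : RFMDP S A) {X Y : Set S} (h : X ⊆ Y) :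
    M.restrictedPolicies X ⊆ M.restrictedPolicies Y :=
  fun _ hπ s hs => hπ s fun hX => hs (h hX)

theorem mem_TL (M : RFMDP S A) {L : ℝ} {X : Set S} {s : S} :
    s ∈ M.TL L X ↔ ⨅ π ∈ M.restrictedPolicies X, M.V π s M.s0 ≤ ENNReal.ofReal L :=
  Iff.rfl

theorem mem_TL_of_policy (M : RFMDP S A) {L : ℝ} {X : Set S} {s : S} {π : S → A}
    (hπ : π ∈ M.restrictedPolicies X) (hV : M.V π s M.s0 ≤ ENNReal.ofReal L) : s ∈ M.TL L X :=
  M.mem_TL.2 (iInf₂_le_of_le π hπ hV)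

theorem exists_policy_of_mem_TL [Finite S] [Finite A] (M : RFMDP S A) {L : ℝ} {X : Set S} {s : S}
    (h : s ∈ M.TL L X) :
    ∃ π ∈ M.restrictedPolicies X, M.V π s M.s0 ≤ ENNReal.ofReal L := by
  have hne : (M.restrictedPolicies X).Nonempty := ⟨fun _ => M.reset, fun _ _ => rfl⟩
  obtain ⟨π, hπ, hmin⟩ :=
    (M.restrictedPolicies X).exists_min_image (fun π => M.V π s M.s0) (Set.toFinite _) hne
  exact ⟨π, hπ, (le_iInf₂ hmin).trans h⟩

theorem TL_mono (M : RFMDP S A) (L : ℝ) : Monotone (M.TL L) :=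
  fun _ _ h _ hs => M.mem_TL.2 ((biInf_mono (M.restrictedPolicies_mono h)).trans (M.mem_TL.1 hs))

theorem V_self (M : RFMDP S A) (π : S → A) (s : S) : M.V π s s = 0 := by
  refine ENNReal.tsum_eq_zero.2 fun n => ?_
  cases n <;> simp [survive]

theorem s0_mem_TL (M : RFMDP S A) (L : ℝ) (X : Set S) : M.s0 ∈ M.TL L X :=
  M.mem_TL_of_policy (π := fun _ => M.reset) (fun _ _ => rfl) (by simp [V_self])

theorem layer_mono (M : RFMDP S A) (L : ℝ) : Monotone (M.layer L) := by
  refine monotone_nat_of_le_succ fun n => ?_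
  induction n with
  | zero => exact Set.singleton_subset_iff.2 (M.s0_mem_TL L _)
  | succ n ih => exact M.TL_mono L ih

theorem layer_eq_iUnion_of_succ_eq (M : RFMDP S A) (L : ℝ) {n : ℕ}
    (h : M.layer L (n + 1) = M.layer L n) : M.layer L n = ⋃ i, M.layer L i := by
  have hle : ∀ k, M.layer L (n + k) = M.layer L n := by
    intro k
    induction k with
    | zero => rfl
    | succ k ih => exact (congrArg (M.TL L) ih).trans h
  refine (Set.subset_iUnion (M.layer L) n).antisymm (Set.iUnion_subset fun i => ?_)
  exact (M.layer_mono L (Nat.le_add_left i n)).trans (hle i).subset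

theorem layer_eq_iUnion_or_lt_ncard [Finite S] (M : RFMDP S A) (L : ℝ) (n : ℕ) :
    M.layer L n = ⋃ i, M.layer L i ∨ n < (M.layer L n).ncard := by
  induction n with
  | zero => right; simp [layer]
  | succ n ih =>
    rcases ih with h | h
    · left
      refine (Set.subset_iUnion (M.layer L) (n + 1)).antisymm ?_
      exact h.symm.subset.trans (M.layer_mono L n.le_succ)
    · by_cases heq : M.layer L (n + 1) = M.layer L n
      · left
        rw [heq]
        exact M.layer_eq_iUnion_of_succ_eq L heq
      · right
        have : (M.layer L n).ncard < (M.layer L (n + 1)).ncard := Set.ncard_lt_ncard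
          ((M.layer_mono L n.le_succ).ssubset_of_ne (Ne.symm heq)) (Set.toFinite _)
        omega

theorem layer_eq_iUnion_of_ncard_le [Finite S] (M : RFMDP S A) (L : ℝ) {n : ℕ}
    (hn : (⋃ i, M.layer L i).ncard ≤ n + 1) : M.layer L n = ⋃ i, M.layer L i := by
  rcases M.layer_eq_iUnion_or_lt_ncard L n with h | h
  · exact h
  · exact Set.eq_of_subset_of_ncard_le (Set.subset_iUnion (M.layer L) n) (by omega)
      (Set.toFinite _)

theorem SLprec_subset_of_TL_subset (M : RFMDP S A) {L : ℝ} (prec : S → S → Prop) {X : Set S}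
    (h0 : M.s0 ∈ X) (hX : M.TL L X ⊆ X) : M.SLprec L prec ⊆ X := by
  refine Set.sInter_subset_of_mem ⟨h0, fun s hs => hX ?_⟩
  obtain ⟨π, hπ, hV⟩ := hs
  exact M.mem_TL_of_policy (M.restrictedPolicies_mono (Set.sep_subset _ _) hπ) hV

/-- `s'` enters the layer sequence strictly before `s` does. -/
def layerPrec (M : RFMDP S A) (L : ℝ) (s' s : S) : Prop :=
  ∃ n, s' ∈ M.layer L n ∧ s ∉ M.layer L n

theorem layerPrec_isStrictOrder (M : RFMDP S A) (L : ℝ) : IsStrictOrder S (M.layerPrec L) where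
  irrefl := fun _ ⟨_, h, h'⟩ => h' h
  trans := by
    rintro a b c ⟨n, ha, hb⟩ ⟨m, hb', hc⟩
    rcases le_total n m with h | h
    · exact ⟨m, M.layer_mono L h ha, hc⟩
    · exact absurd (M.layer_mono L h hb') hb

theorem layer_subset_SLprec_layerPrec [Finite S] [Finite A] (M : RFMDP S A) (L : ℝ) (n : ℕ) :
    M.layer L n ⊆ M.SLprec L (M.layerPrec L) := by
  refine Set.subset_sInter ?_
  rintro X ⟨h0, hX⟩
  induction n with
  | zero => exact Set.singleton_subset_iff.2 h0
  | succ n ih =>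
    intro s (hs : s ∈ M.TL L (M.layer L n))
    by_cases hsn : s ∈ M.layer L n
    · exact ih hsn
    · obtain ⟨π, hπ, hV⟩ := M.exists_policy_of_mem_TL hs
      refine hX s ⟨π, M.restrictedPolicies_mono ?_ hπ, hV⟩
      exact fun s' hs' => ⟨ih hs', n, hs', hsn⟩

theorem SLarrow_eq_iUnion_layer [Finite S] [Finite A] (M : RFMDP S A) (L : ℝ) :
    M.SLarrow L = ⋃ n, M.layer L n := by
  apply Set.Subset.antisymm
  · refine Set.iUnion₂_subset fun prec _ => M.SLprec_subset_of_TL_subset prec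
      (Set.mem_iUnion_of_mem 0 rfl) ?_
    conv_lhs => rw [← M.layer_eq_iUnion_of_ncard_le L (Nat.le_succ _)]
    exact Set.subset_iUnion (M.layer L) (_ + 1)
  · exact Set.iUnion_subset fun n => (M.layer_subset_SLprec_layerPrec L n).trans
      (Set.subset_iUnion₂_of_subset _ (M.layerPrec_isStrictOrder L) subset_rfl)

end RFMDP

/-- there exists `J ≤ |S→_L|` such that `K*_j = S→_L` for all `j ≥ J`
(recall `layer n = K*_{n+1}`, so `K*_j = S→_L` for `j ≥ J` reads
`layer n = S→_L` whenever `J ≤ n + 1`); in particular the `J`-fold iterate of `T_L`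
starting from `{s0}` equals `S→_L`, which is thus the limit of the iterates. -/
theorem layer_stabilizes_at_SLarrow
    {S A : Type} [Finite S] [Finite A] (M : RFMDP S A) (L : ℝ) (hL : 1 ≤ L) :
    ∃ J : ℕ, 1 ≤ J ∧ J ≤ (M.SLarrow L).ncard ∧
      ∀ j : ℕ, J ≤ j + 1 → M.layer L j = M.SLarrow L := by
  rw [M.SLarrow_eq_iUnion_layer L]
  refine ⟨_, ?_, le_rfl, fun j hj => M.layer_eq_iUnion_of_ncard_le L hj⟩
  exact (Set.ncard_pos (Set.toFinite _)).2 ⟨M.s0, Set.mem_iUnion.2 ⟨0, rfl⟩⟩
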